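/- For fixed x⋆ ∈ (0,1], the function F_f(y) = (y e^{(x⋆-2)y} + y e^{-x⋆ y})/(2(1 - e^{-2y})) is strictly decreasing on the interval (1/x⋆, ∞). -/

import Mathlib

lemma aux_dec (a u v : ℝ) (hu : 0 < u) (hau : 1 < a * u) (huv : u < v) :
    v * Real.exp (-a * v) < u * Real.exp (-a * u) := by
  have h1 : Real.exp (-a * u) = Real.exp (a * (v - u)) * Real.exp (-a * v) := by
    rw [← Real.exp_add]; congr 1; ring
  rw [h1, ← mul_assoc]
  apply mul_lt_mul_of_pos_right _ (Real.exp_pos _)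
  have h2 := Real.add_one_le_exp (a * (v - u))
  have h3 := mul_le_mul_of_nonneg_left h2 hu.le
  have h4 : 0 < (a * u - 1) * (v - u) := mul_pos (by linarith) (by linarith)
  nlinarith

theorem stmt_8 (x : ℝ) (hx : x ∈ Set.Ioc (0:ℝ) 1) :
    StrictAntiOn (fun y : ℝ =>
        (y * Real.exp ((x - 2) * y) + y * Real.exp (-x * y)) /
          (2 * (1 - Real.exp (-2 * y))))
      (Set.Ioi (1 / x)) := by
  obtain ⟨hx0, hx1⟩ := hx
  intro u hu v hv huv
  have hu' : 1 / x < u := hu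
  have hu0 : 0 < u := lt_trans (by positivity) hu'
  have hxu : 1 < x * u := by
    rw [div_lt_iff₀ hx0] at hu'; linarith
  have h1 := aux_dec x u v hu0 hxu huv
  have h2 := aux_dec (2 - x) u v hu0 (by nlinarith) huv
  rw [show -(2 - x) = x - 2 by ring] at h2
  have h3 : Real.exp (-2 * v) < Real.exp (-2 * u) := Real.exp_lt_exp.mpr (by linarith)
  have h4 : Real.exp (-2 * u) < 1 := Real.exp_lt_one_iff.mpr (by linarith)
  exact div_lt_div₀ (by linarith) (by linarith) (by positivity) (by linarith)
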